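/- arXiv:2005.06116 — 2 statements merged into one kernel-verified Lean document; each statement's English description precedes it below -/
import Mathlib

section
/- Let α > 1 be real, β ∈ ℂ with Re β > −1, C > 0, set κ = 1/(α−1), and fix any A > max(1, (π/(2α))^κ). There exist constants K > 0 and x₀ > 1 such that for all z = x + iy with x ≥ x₀ and |y| ≤ C log(2 + |x|)/(1 + |x|)^κ, one has |G_{α,β}(z)| ≤ K x^{AC + (Re β + 1)/(α−1)}. -/
open MeasureTheory Set

/-- The entire extension of the Fourier–Laplace transform `F_{α,β}`. -/
noncomputable def Gab (α : ℝ) (β : ℂ) (z : ℂ) : ℂ :=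
  Complex.exp (Complex.I * Real.pi * (β + 1) / (2 * α)) *
    ∫ t in Ioi (0:ℝ), (t : ℂ) ^ β *
      Complex.exp (-(↑(t ^ α) : ℂ) -
        Complex.I * Complex.exp (Complex.I * Real.pi / (2 * α)) * z * t)

/-- The integrand `t ^ β * exp (i t ^ α - i z t) dt` in the logarithmic coordinate `t = exp w`. -/
noncomputable def logIntegrand (α : ℝ) (β z w : ℂ) : ℂ :=
  Complex.exp ((β + 1) * w + Complex.I * Complex.exp (α * w) - Complex.I * z * Complex.exp w)

lemma differentiable_logIntegrand (α : ℝ) (β z : ℂ) : Differentiable ℂ (logIntegrand α β z) := by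
  unfold logIntegrand
  fun_prop

lemma norm_logIntegrand (α : ℝ) (β z : ℂ) (u v : ℝ) :
    ‖logIntegrand α β z (u + v * Complex.I)‖ =
      Real.exp ((β.re + 1) * u - β.im * v - Real.exp (α * u) * Real.sin (α * v) +
        Real.exp u * (z.re * Real.sin v + z.im * Real.cos v)) := by
  unfold logIntegrand
  rw [Complex.norm_exp]
  congr 1
  simp [Complex.exp_re, Complex.exp_im]
  ring

lemma norm_logIntegrand_ofReal (α : ℝ) (β z : ℂ) (u : ℝ) :
    ‖logIntegrand α β z u‖ = Real.exp ((β.re + 1) * u + Real.exp u * z.im) := by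
  have h := norm_logIntegrand α β z u 0
  simpa using h

/-- Crude bound on the strip, used near `Re w = -∞`. -/
lemma norm_logIntegrand_le {α : ℝ} (hα : 1 < α) (β : ℂ) {z : ℂ} (hz : 0 ≤ z.re) {u v L : ℝ}
    (hu : u ≤ L) (hv0 : 0 ≤ v) (hv : v ≤ Real.pi / (2 * α)) :
    ‖logIntegrand α β z (u + v * Complex.I)‖ ≤
      Real.exp (|β.im| * (Real.pi / (2 * α)) + Real.exp L * (z.re + |z.im|)) *
        Real.exp ((β.re + 1) * u) := by
  rw [norm_logIntegrand, ← Real.exp_add]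
  apply Real.exp_le_exp.2
  have hα0 : 0 < α := by linarith
  have h1 : 0 ≤ Real.sin (α * v) := by
    apply Real.sin_nonneg_of_nonneg_of_le_pi (by positivity)
    have : α * v ≤ α * (Real.pi / (2 * α)) := by gcongr
    have h2 : α * (Real.pi / (2 * α)) = Real.pi / 2 := by field_simp
    linarith [Real.pi_pos]
  have h2 : 0 ≤ Real.exp (α * u) * Real.sin (α * v) := mul_nonneg (Real.exp_pos _).le h1
  have h3 : -(β.im * v) ≤ |β.im| * (Real.pi / (2 * α)) := by
    calc -(β.im * v) = -β.im * v := by ring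
      _ ≤ |β.im| * v := by gcongr; exact neg_le_abs _
      _ ≤ _ := by gcongr
  have h4 : z.re * Real.sin v + z.im * Real.cos v ≤ z.re + |z.im| := by
    have a1 : z.re * Real.sin v ≤ z.re * 1 := by gcongr; exact Real.sin_le_one v
    have a2 : z.im * Real.cos v ≤ |z.im| := by
      calc z.im * Real.cos v ≤ |z.im * Real.cos v| := le_abs_self _
        _ = |z.im| * |Real.cos v| := abs_mul _ _
        _ ≤ |z.im| * 1 := by gcongr; exact Real.abs_cos_le_one v
        _ = _ := mul_one _
    linarith
  have h5 : Real.exp u * (z.re * Real.sin v + z.im * Real.cos v) ≤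
      Real.exp L * (z.re + |z.im|) := by
    calc _ ≤ Real.exp u * (z.re + |z.im|) := by gcongr
      _ ≤ _ := by gcongr
  linarith

/-- Bound on the arc `|t| = R`, where the decay of `exp (i t ^ α)` beats the growth of
`exp (-i x t)` by Jordan's inequality. -/
lemma norm_logIntegrand_arc_le {α : ℝ} (hα : 1 < α) (β : ℂ) {z : ℂ} (hz : 0 ≤ z.re) {R v : ℝ}
    (hR : 0 < R) (hRz : Real.pi / (2 * α) * z.re ≤ R ^ (α - 1))
    (hv0 : 0 ≤ v) (hv : v ≤ Real.pi / (2 * α)) :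
    ‖logIntegrand α β z (Real.log R + v * Complex.I)‖ ≤
      Real.exp (|β.im| * (Real.pi / (2 * α))) * (R ^ (β.re + 1) * Real.exp (|z.im| * R)) := by
  rw [norm_logIntegrand, Real.exp_log hR, Real.rpow_def_of_pos hR, ← Real.exp_add, ← Real.exp_add]
  apply Real.exp_le_exp.2
  have hα0 : 0 < α := by linarith
  have hαv : α * v ≤ Real.pi / 2 := by
    have : α * v ≤ α * (Real.pi / (2 * α)) := by gcongr
    have h2 : α * (Real.pi / (2 * α)) = Real.pi / 2 := by field_simp
    linarith
  have h1 : 2 / Real.pi * (α * v) ≤ Real.sin (α * v) := Real.mul_le_sin (by positivity) hαv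
  have hRα : Real.exp (α * Real.log R) = R ^ (α - 1) * R := by
    rw [mul_comm, ← Real.rpow_def_of_pos hR, ← Real.rpow_add_one hR.ne']
    simp
  have h3 : -(β.im * v) ≤ |β.im| * (Real.pi / (2 * α)) := by
    calc -(β.im * v) = -β.im * v := by ring
      _ ≤ |β.im| * v := by gcongr; exact neg_le_abs _
      _ ≤ _ := by gcongr
  have a2 : z.im * Real.cos v ≤ |z.im| := by
    calc z.im * Real.cos v ≤ |z.im * Real.cos v| := le_abs_self _
      _ = |z.im| * |Real.cos v| := abs_mul _ _
      _ ≤ |z.im| * 1 := by gcongr; exact Real.abs_cos_le_one v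
      _ = _ := mul_one _
  have a1 : z.re * Real.sin v ≤ R ^ (α - 1) * Real.sin (α * v) := by
    calc z.re * Real.sin v ≤ z.re * v := by gcongr; exact Real.sin_le hv0
      _ = Real.pi / (2 * α) * z.re * (2 / Real.pi * (α * v)) := by
        field_simp
      _ ≤ R ^ (α - 1) * Real.sin (α * v) := by gcongr
  rw [hRα]
  have h5 : R * (z.re * Real.sin v + z.im * Real.cos v) ≤
      R * (R ^ (α - 1) * Real.sin (α * v) + |z.im|) := by gcongr
  linarith

/-- The integral along the rotated ray up to radius `R`, after moving the contour to the
real segment and the arc. -/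
lemma norm_integral_rotated_ray_le {α : ℝ} (hα : 1 < α) {β : ℂ} (hβ : -1 < β.re) {z : ℂ}
    (hz : 0 ≤ z.re) {R a : ℝ}
    (hR : 0 < R) (hRz : Real.pi / (2 * α) * z.re ≤ R ^ (α - 1)) (ha : a ≤ Real.log R) :
    ‖∫ u in a..Real.log R, logIntegrand α β z (u + (Real.pi / (2 * α) : ℝ) * Complex.I)‖ ≤
      (1 / (β.re + 1) + Real.exp (|β.im| * (Real.pi / (2 * α))) * (Real.pi / (2 * α))) *
        (R ^ (β.re + 1) * Real.exp (|z.im| * R)) +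
      Real.exp (|β.im| * (Real.pi / (2 * α)) + R * (z.re + |z.im|)) *
        Real.exp ((β.re + 1) * a) * (Real.pi / (2 * α)) := by
  have hα0 : 0 < α := by linarith
  have hb : 0 < β.re + 1 := by linarith
  set φ := Real.pi / (2 * α) with hφ
  have hφ0 : 0 < φ := by positivity
  have hcauchy := Complex.integral_boundary_rect_eq_zero_of_differentiableOn
    (logIntegrand α β z) (a : ℂ) (Real.log R + φ * Complex.I)
    (differentiable_logIntegrand α β z).differentiableOn
  simp only [Complex.ofReal_re, Complex.ofReal_im, Complex.add_re, Complex.add_im,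
    Complex.mul_re, Complex.mul_im, Complex.I_re, Complex.I_im, mul_zero, mul_one, zero_mul,
    sub_zero, add_zero, zero_add, Complex.ofReal_zero, smul_eq_mul] at hcauchy
  have hbot : ‖∫ u in a..Real.log R, logIntegrand α β z (u : ℂ)‖ ≤
      1 / (β.re + 1) * (R ^ (β.re + 1) * Real.exp (|z.im| * R)) := by
    have hint : ∫ u in a..Real.log R, Real.exp (|z.im| * R) * Real.exp ((β.re + 1) * u) =
        Real.exp (|z.im| * R) * ((β.re + 1)⁻¹ *
          (Real.exp ((β.re + 1) * Real.log R) - Real.exp ((β.re + 1) * a))) := by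
      rw [intervalIntegral.integral_const_mul, intervalIntegral.integral_comp_mul_left _ hb.ne',
        integral_exp, smul_eq_mul]
    calc _ ≤ ∫ u in a..Real.log R, Real.exp (|z.im| * R) * Real.exp ((β.re + 1) * u) := by
          apply intervalIntegral.norm_integral_le_of_norm_le ha
          · refine Filter.Eventually.of_forall fun u hu => ?_
            rw [norm_logIntegrand_ofReal, ← Real.exp_add]
            apply Real.exp_le_exp.2
            have h1 : Real.exp u ≤ R := (Real.le_log_iff_exp_le hR).1 hu.2
            have : Real.exp u * z.im ≤ R * |z.im| := by
              calc _ ≤ Real.exp u * |z.im| := by gcongr; exact le_abs_self _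
                _ ≤ _ := by gcongr
            linarith
          · apply Continuous.intervalIntegrable
            fun_prop
      _ ≤ Real.exp (|z.im| * R) * ((β.re + 1)⁻¹ * Real.exp ((β.re + 1) * Real.log R)) := by
          rw [hint]
          gcongr
          linarith [Real.exp_pos ((β.re + 1) * a)]
      _ = _ := by
          rw [Real.rpow_def_of_pos hR, mul_comm (Real.log R)]
          ring
  have hright : ‖∫ v in (0:ℝ)..φ, logIntegrand α β z (Real.log R + v * Complex.I)‖ ≤
      Real.exp (|β.im| * φ) * (R ^ (β.re + 1) * Real.exp (|z.im| * R)) * |φ - 0| := by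
    apply intervalIntegral.norm_integral_le_of_norm_le_const
    intro v hv
    rw [uIoc_of_le hφ0.le] at hv
    exact norm_logIntegrand_arc_le hα β hz hR hRz hv.1.le hv.2
  have hleft : ‖∫ v in (0:ℝ)..φ, logIntegrand α β z (a + v * Complex.I)‖ ≤
      Real.exp (|β.im| * φ + R * (z.re + |z.im|)) * Real.exp ((β.re + 1) * a) * |φ - 0| := by
    apply intervalIntegral.norm_integral_le_of_norm_le_const
    intro v hv
    rw [uIoc_of_le hφ0.le] at hv
    have := norm_logIntegrand_le hα β hz ha hv.1.le hv.2
    rwa [Real.exp_log hR] at this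
  rw [sub_zero, abs_of_pos hφ0] at hright hleft
  set T := ∫ u in a..Real.log R, logIntegrand α β z (u + φ * Complex.I)
  set B := ∫ u in a..Real.log R, logIntegrand α β z (u : ℂ)
  set Q := ∫ v in (0:ℝ)..φ, logIntegrand α β z (Real.log R + v * Complex.I)
  set P := ∫ v in (0:ℝ)..φ, logIntegrand α β z (a + v * Complex.I)
  have hT : T = B + Complex.I * Q - Complex.I * P := by linear_combination -hcauchy
  have : ‖T‖ ≤ ‖B‖ + ‖Q‖ + ‖P‖ := by
    rw [hT]
    refine (norm_sub_le _ _).trans ?_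
    have := norm_add_le B (Complex.I * Q)
    simp only [norm_mul, Complex.norm_I, one_mul] at this ⊢
    linarith
  linarith

/-- The integrand of `Gab`. -/
noncomputable def rayIntegrand (α : ℝ) (β z : ℂ) (t : ℝ) : ℂ :=
  (t : ℂ) ^ β * Complex.exp (-(↑(t ^ α) : ℂ) -
    Complex.I * Complex.exp (Complex.I * Real.pi / (2 * α)) * z * t)

lemma exp_smul_rayIntegrand {α : ℝ} (hα : α ≠ 0) (β z : ℂ) (u : ℝ) :
    Complex.exp (Complex.I * Real.pi * (β + 1) / (2 * α)) *
      (Real.exp u • rayIntegrand α β z (Real.exp u)) =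
      logIntegrand α β z (u + (Real.pi / (2 * α) : ℝ) * Complex.I) := by
  have hα' : (α : ℂ) ≠ 0 := by exact_mod_cast hα
  unfold rayIntegrand logIntegrand
  have h1 : (Real.exp u) ^ α = Real.exp (α * u) := by rw [← Real.exp_mul, mul_comm]
  have h2 : ((Real.exp u : ℝ) : ℂ) ^ β = Complex.exp (u * β) := by
    rw [Complex.cpow_def_of_ne_zero (by exact_mod_cast (Real.exp_pos u).ne'),
      ← Complex.ofReal_log (Real.exp_pos u).le, Real.log_exp]
  have h3 : Complex.exp (α * (u + (Real.pi / (2 * α) : ℝ) * Complex.I)) =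
      Complex.exp (α * u) * Complex.I := by
    have : (α : ℂ) * (u + (Real.pi / (2 * α) : ℝ) * Complex.I) =
        α * u + Real.pi / 2 * Complex.I := by
      push_cast
      field_simp
    rw [this, Complex.exp_add, Complex.exp_pi_div_two_mul_I]
  have h4 : Complex.exp (u + (Real.pi / (2 * α) : ℝ) * Complex.I) =
      Complex.exp (Complex.I * Real.pi / (2 * α)) * Complex.exp u := by
    rw [← Complex.exp_add]
    congr 1
    push_cast
    ring
  rw [h1, h2, h3, h4, Complex.real_smul]
  push_cast
  rw [← Complex.exp_add, ← Complex.exp_add, ← Complex.exp_add]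
  congr 1
  have : Complex.I * (Complex.exp (α * u) * Complex.I) = - Complex.exp (α * u) := by
    linear_combination Complex.exp (α * u) * Complex.I_mul_I
  rw [this]
  field_simp
  ring

lemma continuousOn_rayIntegrand (α : ℝ) (β z : ℂ) :
    ContinuousOn (rayIntegrand α β z) (Ioi 0) := by
  unfold rayIntegrand
  refine ContinuousOn.mul ?_ ?_
  · intro t ht
    exact (Complex.continuousAt_ofReal_cpow_const t β (Or.inr (ne_of_gt ht))).continuousWithinAt
  · have : ContinuousOn (fun t : ℝ => t ^ α) (Ioi 0) := fun t ht =>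
      (Real.continuousAt_rpow_const t α (Or.inl (ne_of_gt ht))).continuousWithinAt
    fun_prop

lemma integral_rayIntegrand_eq {α : ℝ} (hα : α ≠ 0) (β z : ℂ) (a L : ℝ) :
    Complex.exp (Complex.I * Real.pi * (β + 1) / (2 * α)) *
      ∫ t in Real.exp a..Real.exp L, rayIntegrand α β z t =
      ∫ u in a..L, logIntegrand α β z (u + (Real.pi / (2 * α) : ℝ) * Complex.I) := by
  rw [← intervalIntegral.integral_deriv_smul_comp''' (f := Real.exp) (f' := Real.exp)]
  · rw [← intervalIntegral.integral_const_mul]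
    congr 1
    funext u
    exact exp_smul_rayIntegrand hα β z u
  · exact Real.continuous_exp.continuousOn
  · exact fun u _ => (Real.hasDerivAt_exp u).hasDerivWithinAt
  · refine (continuousOn_rayIntegrand α β z).mono ?_
    rintro _ ⟨u, -, rfl⟩
    exact Real.exp_pos u
  · refine ContinuousOn.integrableOn_compact ?_ ?_
    · exact (isCompact_uIcc).image Real.continuous_exp
    · refine (continuousOn_rayIntegrand α β z).mono ?_
      rintro _ ⟨u, -, rfl⟩
      exact Real.exp_pos u
  · apply Continuous.integrableOn_uIcc
    refine Real.continuous_exp.smul ?_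
    exact (continuousOn_rayIntegrand α β z).comp_continuous Real.continuous_exp
      (fun u => Real.exp_pos u)

lemma norm_integral_rayIntegrand_initial_le {α : ℝ} (hα : 1 < α) {β : ℂ} (hβ : -1 < β.re)
    {z : ℂ} (hz : 0 ≤ z.re) {R : ℝ}
    (hR : 0 < R) (hRz : Real.pi / (2 * α) * z.re ≤ R ^ (α - 1))
    (hint : IntegrableOn (rayIntegrand α β z) (Ioi 0)) :
    ‖Complex.exp (Complex.I * Real.pi * (β + 1) / (2 * α)) *
      ∫ t in (0:ℝ)..R, rayIntegrand α β z t‖ ≤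
      (1 / (β.re + 1) + Real.exp (|β.im| * (Real.pi / (2 * α))) * (Real.pi / (2 * α))) *
        (R ^ (β.re + 1) * Real.exp (|z.im| * R)) := by
  have hb : 0 < β.re + 1 := by linarith
  have hexp : Filter.Tendsto Real.exp Filter.atBot (nhds 0) := Real.tendsto_exp_atBot
  have hsub : Filter.Tendsto (fun a : ℝ => ∫ t in Real.exp a..R, rayIntegrand α β z t)
      Filter.atBot (nhds (∫ t in (0:ℝ)..R, rayIntegrand α β z t)) := by
    have hii : IntervalIntegrable (rayIntegrand α β z) volume R 0 := by
      rw [intervalIntegrable_iff, uIoc_comm, uIoc_of_le hR.le]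
      exact hint.mono_set Ioc_subset_Ioi_self
    have hc := intervalIntegral.continuousOn_primitive_interval'
      (μ := volume) (f := rayIntegrand α β z) (a := R) hii left_mem_uIcc
    have h0 := hc 0 right_mem_uIcc
    have h1 : Filter.Tendsto Real.exp Filter.atBot (nhdsWithin 0 (uIcc R 0)) := by
      refine tendsto_nhdsWithin_iff.2 ⟨hexp, ?_⟩
      filter_upwards [Filter.eventually_le_atBot (Real.log R)] with a ha
      rw [uIcc_comm, uIcc_of_le hR.le]
      exact ⟨(Real.exp_pos a).le, (Real.le_log_iff_exp_le hR).1 ha⟩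
    have h2 := (Filter.Tendsto.comp h0 h1).neg
    simpa only [Function.comp_def, ← intervalIntegral.integral_symm] using h2
  have hlim : Filter.Tendsto (fun a : ℝ =>
      (1 / (β.re + 1) + Real.exp (|β.im| * (Real.pi / (2 * α))) * (Real.pi / (2 * α))) *
        (R ^ (β.re + 1) * Real.exp (|z.im| * R)) +
      Real.exp (|β.im| * (Real.pi / (2 * α)) + R * (z.re + |z.im|)) *
        Real.exp ((β.re + 1) * a) * (Real.pi / (2 * α))) Filter.atBot (nhds (
      (1 / (β.re + 1) + Real.exp (|β.im| * (Real.pi / (2 * α))) * (Real.pi / (2 * α))) *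
        (R ^ (β.re + 1) * Real.exp (|z.im| * R)) +
      Real.exp (|β.im| * (Real.pi / (2 * α)) + R * (z.re + |z.im|)) *
        0 * (Real.pi / (2 * α)))) := by
    refine tendsto_const_nhds.add ((Filter.Tendsto.const_mul _ ?_).mul_const _)
    exact Real.tendsto_exp_atBot.comp (Filter.tendsto_id.const_mul_atBot hb)
  rw [mul_zero, zero_mul, add_zero] at hlim
  refine le_of_tendsto_of_tendsto (hsub.const_mul _).norm hlim ?_
  filter_upwards [Filter.eventually_le_atBot (Real.log R)] with a ha
  have := integral_rayIntegrand_eq (by linarith : α ≠ 0) β z a (Real.log R)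
  rw [Real.exp_log hR] at this
  rw [this]
  exact norm_integral_rotated_ray_le hα hβ hz hR hRz ha

lemma norm_rayIntegrand {α : ℝ} (β z : ℂ) {t : ℝ} (ht : 0 < t) :
    ‖rayIntegrand α β z t‖ = t ^ β.re * Real.exp (-t ^ α +
      (z.re * Real.sin (Real.pi / (2 * α)) + z.im * Real.cos (Real.pi / (2 * α))) * t) := by
  unfold rayIntegrand
  rw [norm_mul, Complex.norm_cpow_eq_rpow_re_of_pos ht, Complex.norm_exp]
  congr 2
  have : Complex.I * Real.pi / (2 * α) = (Real.pi / (2 * α) : ℝ) * Complex.I := by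
    push_cast
    ring
  rw [this]
  generalize Real.pi / (2 * α) = φ
  simp [Complex.exp_mul_I, Complex.sin_ofReal_re, Complex.cos_ofReal_re,
    -Complex.ofReal_sin, -Complex.ofReal_cos]
  ring

/-- Beyond radius `R` the factor `exp (-t ^ α)` dominates. -/
lemma norm_integral_rayIntegrand_tail_le {α : ℝ} (hα : 1 < α) {β : ℂ} (hβ : -1 < β.re)
    {z : ℂ} (hz : 0 ≤ z.re) {R c : ℝ} (hR : 0 < R) (hc : 0 < c)
    (hRz : z.re + |z.im| ≤ (1 - c) * R ^ (α - 1)) :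
    ‖∫ t in Ioi R, rayIntegrand α β z t‖ ≤
      ∫ t in Ioi (0:ℝ), t ^ β.re * Real.exp (-c * t ^ α) := by
  have hI : IntegrableOn (fun t : ℝ => t ^ β.re * Real.exp (-c * t ^ α)) (Ioi 0) :=
    integrableOn_rpow_mul_exp_neg_mul_rpow hβ (by linarith) hc
  have hc1 : 0 ≤ 1 - c := by
    by_contra h
    have h1 : (1 - c) * R ^ (α - 1) < 0 :=
      mul_neg_of_neg_of_pos (not_le.1 h) (Real.rpow_pos_of_pos hR _)
    linarith [abs_nonneg z.im]
  calc _ ≤ ∫ t in Ioi R, t ^ β.re * Real.exp (-c * t ^ α) := by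
        apply norm_integral_le_of_norm_le (hI.mono_set (Ioi_subset_Ioi hR.le))
        filter_upwards [ae_restrict_mem measurableSet_Ioi] with t ht
        have ht' : R < t := ht
        have ht0 : 0 < t := hR.trans ht'
        rw [norm_rayIntegrand β z ht0]
        gcongr
        set φ := Real.pi / (2 * α)
        have a1 : z.re * Real.sin φ ≤ z.re * 1 := by gcongr; exact Real.sin_le_one φ
        have a2 : z.im * Real.cos φ ≤ |z.im| := by
          calc z.im * Real.cos φ ≤ |z.im * Real.cos φ| := le_abs_self _
            _ = |z.im| * |Real.cos φ| := abs_mul _ _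
            _ ≤ |z.im| * 1 := by gcongr; exact Real.abs_cos_le_one φ
            _ = _ := mul_one _
        have a3 : (1 - c) * R ^ (α - 1) ≤ (1 - c) * t ^ (α - 1) := by
          gcongr
        have a4 : t ^ α = t ^ (α - 1) * t := by
          rw [← Real.rpow_add_one ht0.ne']
          simp
        have a5 : (z.re * Real.sin φ + z.im * Real.cos φ) * t ≤ (1 - c) * t ^ (α - 1) * t := by
          gcongr
          linarith
        rw [a4]
        linarith
    _ ≤ _ := by
        apply setIntegral_mono_set hI
        · filter_upwards [ae_restrict_mem measurableSet_Ioi] with t ht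
          have ht0 : (0:ℝ) < t := ht
          simp only [Pi.zero_apply]
          positivity
        · exact (Ioi_subset_Ioi hR.le).eventuallyLE

/-- The height of the hourglass region is bounded. -/
lemma log_two_add_div_rpow_le {κ x : ℝ} (hκ : 0 < κ) (hx : 0 ≤ x) :
    Real.log (2 + x) / (1 + x) ^ κ ≤ 2 ^ κ / κ := by
  rw [div_le_iff₀ (by positivity)]
  calc Real.log (2 + x) ≤ (2 + x) ^ κ / κ := Real.log_le_rpow_div (by linarith) hκ
    _ ≤ (2 * (1 + x)) ^ κ / κ := by
        gcongr
        linarith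
    _ = _ := by
        rw [Real.mul_rpow (by norm_num) (by linarith)]
        ring

/-- Bound for `G_{α,β}` on the positive-real part of the hourglass-shaped
region `|y| ≤ C log(2+|x|)/(1+|x|)^κ`, `κ = 1/(α−1)`, for any fixed
`A > max(1, (π/(2α))^κ)`. -/
theorem stmt_9 (α : ℝ) (hα : 1 < α) (β : ℂ) (hβ : -1 < β.re) (C : ℝ) (hC : 0 < C)
    (A : ℝ) (hA : max 1 ((Real.pi / (2 * α)) ^ (1 / (α - 1))) < A) :
    ∃ K x₀ : ℝ, 0 < K ∧ 1 < x₀ ∧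
      ∀ z : ℂ, x₀ ≤ z.re →
        |z.im| ≤ C * Real.log (2 + |z.re|) / (1 + |z.re|) ^ (1 / (α - 1)) →
        ‖Gab α β z‖ ≤ K * z.re ^ (A * C + (β.re + 1) / (α - 1)) := by
  obtain ⟨hA1, hA2⟩ := max_lt_iff.1 hA
  have hα1 : 0 < α - 1 := by linarith
  have hα0 : 0 < α := by linarith
  have hb : 0 < β.re + 1 := by linarith
  have hA0 : 0 < A := by linarith
  set κ := 1 / (α - 1) with hκ
  have hκ0 : 0 < κ := by positivity
  have hκα : κ * (α - 1) = 1 := by rw [hκ]; field_simp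
  set φ := Real.pi / (2 * α) with hφ
  have hφ0 : 0 < φ := by positivity
  have hφA : φ ≤ A ^ (α - 1) := by
    calc φ = (φ ^ κ) ^ (α - 1) := by rw [← Real.rpow_mul hφ0.le, hκα, Real.rpow_one]
      _ ≤ A ^ (α - 1) := by gcongr
  have hA3 : 1 < A ^ (α - 1) := Real.one_lt_rpow hA1 hα1
  set D := A ^ (α - 1) with hD
  set M := C * (2 ^ κ / κ) with hM
  have hM0 : 0 < M := by positivity
  set c := (1 - 1 / D) / 2 with hc
  have hc0 : 0 < c := by
    have : 1 / D < 1 := by rw [div_lt_one (by linarith)]; exact hA3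
    rw [hc]; linarith
  have hcD : (1 - c) * D = 1 + c * D := by
    rw [hc]; field_simp; ring
  set K1 := ∫ t in Ioi (0:ℝ), t ^ β.re * Real.exp (-c * t ^ α) with hK1
  have hK10 : 0 ≤ K1 := setIntegral_nonneg measurableSet_Ioi fun t ht => by
    have ht0 : (0:ℝ) < t := ht
    positivity
  set N := ‖Complex.exp (Complex.I * Real.pi * (β + 1) / (2 * α))‖
  set K2 := 1 / (β.re + 1) + Real.exp (|β.im| * φ) * φ with hK2
  have hK20 : 0 < K2 := by positivity
  refine ⟨K2 * (A ^ (β.re + 1) * 3 ^ (A * C)) + N * K1, max 2 (M / (c * D)), by positivity,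
    lt_of_lt_of_le (by norm_num) (le_max_left _ _), ?_⟩
  intro z hz hy
  have hx2 : 2 ≤ z.re := (le_max_left _ _).trans hz
  have hxM : M ≤ z.re * (c * D) := (div_le_iff₀ (by positivity)).1 ((le_max_right _ _).trans hz)
  have hx0 : 0 < z.re := by linarith
  rw [abs_of_pos hx0] at hy
  have hyM : |z.im| ≤ M := by
    refine hy.trans ?_
    rw [mul_div_assoc]
    exact mul_le_mul_of_nonneg_left (log_two_add_div_rpow_le hκ0 hx0.le) hC.le
  set R := A * z.re ^ κ with hRdef
  have hR : 0 < R := by positivity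
  have hRα : R ^ (α - 1) = D * z.re := by
    rw [hRdef, Real.mul_rpow hA0.le (by positivity), ← Real.rpow_mul hx0.le, hκα, Real.rpow_one]
  have hE0 : 0 ≤ A * C + (β.re + 1) / (α - 1) := by positivity
  have hGab : Gab α β z = Complex.exp (Complex.I * Real.pi * (β + 1) / (2 * α)) *
    ∫ t in Ioi (0:ℝ), rayIntegrand α β z t := rfl
  by_cases hint : IntegrableOn (rayIntegrand α β z) (Ioi 0)
  swap
  · rw [hGab, integral_undef hint, mul_zero, norm_zero]
    positivity
  have hsplit : ∫ t in Ioi (0:ℝ), rayIntegrand α β z t =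
      (∫ t in (0:ℝ)..R, rayIntegrand α β z t) + ∫ t in Ioi R, rayIntegrand α β z t :=
    (intervalIntegral.integral_interval_add_Ioi hint (hint.mono_set (Ioi_subset_Ioi hR.le))).symm
  have h1 := norm_integral_rayIntegrand_initial_le hα hβ hx0.le hR
    (by rw [hRα]; gcongr) hint
  have h2 := norm_integral_rayIntegrand_tail_le hα hβ hx0.le hR hc0
    (by rw [hRα, ← mul_assoc, hcD]; linarith)
  have hyR : |z.im| * R ≤ Real.log (2 + z.re) * (A * C) := by
    calc |z.im| * R ≤ C * Real.log (2 + z.re) / (1 + z.re) ^ κ * (A * (1 + z.re) ^ κ) := by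
          rw [hRdef]
          have : 0 ≤ Real.log (2 + z.re) := Real.log_nonneg (by linarith)
          gcongr
          linarith
      _ = _ := by
          have : 0 < (1 + z.re) ^ κ := by positivity
          field_simp
  have hexp : Real.exp (|z.im| * R) ≤ 3 ^ (A * C) * z.re ^ (A * C) := by
    calc _ ≤ (2 + z.re) ^ (A * C) := by
          rw [Real.rpow_def_of_pos (by linarith)]
          exact Real.exp_le_exp.2 hyR
      _ ≤ (3 * z.re) ^ (A * C) := by
          gcongr
          linarith
      _ = _ := Real.mul_rpow (by norm_num) hx0.le
  have hRb : R ^ (β.re + 1) = A ^ (β.re + 1) * z.re ^ ((β.re + 1) / (α - 1)) := by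
    rw [hRdef, Real.mul_rpow hA0.le (by positivity), ← Real.rpow_mul hx0.le]
    congr 2
    rw [hκ]
    ring
  have hone : 1 ≤ z.re ^ (A * C + (β.re + 1) / (α - 1)) :=
    Real.one_le_rpow (by linarith) hE0
  rw [hGab, hsplit, mul_add]
  refine (norm_add_le _ _).trans ?_
  rw [add_mul]
  refine add_le_add (h1.trans ?_) ?_
  · rw [hRb, Real.rpow_add hx0]
    calc _ ≤ K2 * (A ^ (β.re + 1) * z.re ^ ((β.re + 1) / (α - 1)) *
          (3 ^ (A * C) * z.re ^ (A * C))) := by gcongr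
      _ = _ := by ring
  · rw [norm_mul]
    calc _ ≤ N * K1 := by gcongr
      _ ≤ _ := le_mul_of_one_le_right (by positivity) hone
end

section
/- Let κ > 0. The Laplace transform L(s) = ∫₀^∞ exp(i t^{1+1/κ}) e^{−st} dt converges absolutely for Re s > 0, and the function s ↦ L(s) extends to an entire function L̃ on ℂ. Moreover, for every C > 0 there exist constants M > 0 and N ≥ 0 such that |L̃(s)| ≤ M (1 + |s|)^N for every s ∈ ℂ with Re s ≥ −C log(2 + |Im s|) / (1 + |Im s|)^κ. -/
open MeasureTheory Set

open Filter Topology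

/-- The Fourier–Laplace integral `∫ g e^{-sp} dμ` is entire in `s` when `g` has all
exponential moments with respect to `p`. -/
lemma differentiable_integral_mul_exp {X : Type*} [MeasurableSpace X] {μ : Measure X}
    {g p : X → ℂ} (hg : AEStronglyMeasurable g μ) (hp : AEStronglyMeasurable p μ)
    (h : ∀ A : ℝ, Integrable (fun x => ‖g x‖ * Real.exp (A * ‖p x‖)) μ) :
    Differentiable ℂ (fun s : ℂ => ∫ x, g x * Complex.exp (-(s * p x)) ∂μ) := by
  intro s₀
  have hexp : ∀ s : ℂ, AEStronglyMeasurable (fun x => Complex.exp (-(s * p x))) μ := fun s =>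
    Complex.continuous_exp.comp_aestronglyMeasurable (hp.const_mul s).neg
  have hnorm : ∀ (s : ℂ) (x : X), ‖Complex.exp (-(s * p x))‖ ≤ Real.exp (‖s‖ * ‖p x‖) := by
    intro s x
    refine (Complex.norm_exp_le_exp_norm _).trans (le_of_eq ?_)
    rw [norm_neg, norm_mul]
  refine (hasDerivAt_integral_of_dominated_loc_of_deriv_le
    (F := fun (s : ℂ) x => g x * Complex.exp (-(s * p x)))
    (F' := fun (s : ℂ) x => g x * (Complex.exp (-(s * p x)) * -(p x)))
    (bound := fun x => ‖g x‖ * Real.exp ((‖s₀‖ + 2) * ‖p x‖))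
    (Metric.ball_mem_nhds s₀ one_pos) ?_ ?_ ?_ ?_ (h _) ?_).2.differentiableAt
  · exact Eventually.of_forall fun s => hg.mul (hexp s)
  · refine (h ‖s₀‖).mono' (hg.mul (hexp s₀)) (Eventually.of_forall fun x => ?_)
    rw [norm_mul]
    exact mul_le_mul_of_nonneg_left (hnorm _ _) (norm_nonneg _)
  · exact hg.mul ((hexp s₀).mul hp.neg)
  · refine Eventually.of_forall fun x s hs => ?_
    rw [norm_mul, norm_mul, norm_neg]
    refine mul_le_mul_of_nonneg_left ?_ (norm_nonneg _)
    have hs' : ‖s‖ ≤ ‖s₀‖ + 1 := by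
      have h1 : ‖s - s₀‖ < 1 := by simpa [dist_eq_norm] using hs
      have h2 := norm_add_le (s - s₀) s₀
      rw [sub_add_cancel] at h2
      linarith
    calc ‖Complex.exp (-(s * p x))‖ * ‖p x‖
        ≤ Real.exp ((‖s₀‖ + 1) * ‖p x‖) * Real.exp ‖p x‖ := by
          gcongr
          · exact (hnorm s x).trans (by gcongr)
          · linarith [Real.add_one_le_exp ‖p x‖]
      _ = Real.exp ((‖s₀‖ + 2) * ‖p x‖) := by rw [← Real.exp_add]; ring_nf
  · refine Eventually.of_forall fun x s _ => ?_
    have h1 : HasDerivAt (fun s : ℂ => -(s * p x)) (-(p x)) s := by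
      have h2 := ((hasDerivAt_id s).mul_const (p x)).neg
      rw [one_mul] at h2
      exact h2
    exact h1.cexp.const_mul (g x)

/-- Decay of `exp (i z ^ α)` in the sector `0 ≤ arg z ≤ θ`. -/
lemma norm_exp_I_mul_cpow_le {α θ : ℝ} (hα : 1 ≤ α) (hθ0 : 0 < θ) (hθ : θ < Real.pi / 2)
    (hαθ : α * θ ≤ Real.pi / 2) {z : ℂ} (hre : 0 < z.re) (him : 0 ≤ z.im)
    (hz : z.im * Real.cos θ ≤ z.re * Real.sin θ) :
    ‖Complex.exp (Complex.I * z ^ (α : ℂ))‖ ≤ Real.exp (-(‖z‖ ^ (α - 1) * z.im)) := by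
  have hz0 : z ≠ 0 := by rintro rfl; simp at hre
  have hn : 0 < ‖z‖ := norm_pos_iff.2 hz0
  set φ := Complex.arg z with hφ
  have hφ0 : 0 ≤ φ := Complex.arg_nonneg_iff.2 him
  have hφ1 : φ < Real.pi / 2 := (abs_lt.1 (Complex.abs_arg_lt_pi_div_two_iff.2 (Or.inl hre))).2
  have hcos : ‖z‖ * Real.cos φ = z.re := Complex.norm_mul_cos_arg z
  have hsin : ‖z‖ * Real.sin φ = z.im := Complex.norm_mul_sin_arg z
  have hφθ : φ ≤ θ := by
    by_contra! hlt
    have h1 : 0 < Real.sin (φ - θ) :=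
      Real.sin_pos_of_pos_of_lt_pi (by linarith) (by linarith)
    rw [Real.sin_sub] at h1
    rw [← hcos, ← hsin] at hz
    nlinarith
  have hle : φ * α ≤ Real.pi / 2 := by nlinarith
  have hsin_le : Real.sin φ ≤ Real.sin (φ * α) :=
    Real.sin_le_sin_of_le_of_le_pi_div_two (by linarith [Real.pi_pos]) hle (by nlinarith)
  rw [Complex.norm_exp, Complex.I_mul_re, Complex.cpow_ofReal_im]
  refine Real.exp_le_exp.2 (neg_le_neg ?_)
  calc ‖z‖ ^ (α - 1) * z.im = ‖z‖ ^ (α - 1) * ‖z‖ * Real.sin φ := by rw [← hsin]; ring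
    _ = ‖z‖ ^ α * Real.sin φ := by
        rw [Real.rpow_sub_one hn.ne', div_mul_cancel₀ _ hn.ne']
    _ ≤ ‖z‖ ^ α * Real.sin (φ * α) := by gcongr

lemma norm_exp_neg_mul (s z : ℂ) :
    ‖Complex.exp (-(s * z))‖ = Real.exp (-(s.re * z.re) + s.im * z.im) := by
  rw [Complex.norm_exp]
  congr 1
  simp
  ring

section Ray

variable {α θ T u : ℝ}

lemma ray_re (T u θ : ℝ) :
    ((T : ℂ) + u * Complex.exp (θ * Complex.I)).re = T + u * Real.cos θ := by
  simp [Complex.exp_ofReal_mul_I_re]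

lemma ray_im (T u θ : ℝ) :
    ((T : ℂ) + u * Complex.exp (θ * Complex.I)).im = u * Real.sin θ := by
  simp [Complex.exp_ofReal_mul_I_im]

lemma norm_ray_le (hT : 0 ≤ T) (hu : 0 ≤ u) :
    ‖(T : ℂ) + u * Complex.exp (θ * Complex.I)‖ ≤ T + u := by
  refine (norm_add_le _ _).trans ?_
  rw [norm_mul, Complex.norm_exp_ofReal_mul_I, Complex.norm_real, Complex.norm_real,
    Real.norm_of_nonneg hT, Real.norm_of_nonneg hu, mul_one]

lemma le_norm_ray_left (hu : 0 ≤ u) (hc : 0 ≤ Real.cos θ) :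
    T ≤ ‖(T : ℂ) + u * Complex.exp (θ * Complex.I)‖ := by
  refine le_trans ?_ (Complex.re_le_norm _)
  rw [ray_re]
  nlinarith

lemma le_norm_ray_right (hT : 0 ≤ T) (hu : 0 ≤ u) (hc : 0 ≤ Real.cos θ) :
    u ≤ ‖(T : ℂ) + u * Complex.exp (θ * Complex.I)‖ := by
  refine (sq_le_sq₀ hu (norm_nonneg _)).1 ?_
  rw [Complex.sq_norm, Complex.normSq_apply, ray_re, ray_im]
  nlinarith [Real.sin_sq_add_cos_sq θ, mul_nonneg (mul_nonneg hT hu) hc, sq_nonneg T]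

/-- On the ray, the kernel is at most `exp (-‖z‖^(α-1) u sin θ)`. -/
lemma norm_exp_I_mul_ray_cpow_le (hα : 1 ≤ α) (hθ0 : 0 < θ) (hθ : θ < Real.pi / 2)
    (hαθ : α * θ ≤ Real.pi / 2) (hT : 0 < T) (hu : 0 ≤ u) :
    ‖Complex.exp (Complex.I * ((T : ℂ) + u * Complex.exp (θ * Complex.I)) ^ (α : ℂ))‖ ≤
      Real.exp (-(‖(T : ℂ) + u * Complex.exp (θ * Complex.I)‖ ^ (α - 1) * (u * Real.sin θ))) := by
  have hc : 0 < Real.cos θ := Real.cos_pos_of_mem_Ioo ⟨by linarith, hθ⟩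
  have hs : 0 < Real.sin θ := Real.sin_pos_of_pos_of_lt_pi hθ0 (by linarith)
  rw [← ray_im T u θ]
  apply norm_exp_I_mul_cpow_le hα hθ0 hθ hαθ
  · rw [ray_re]; positivity
  · rw [ray_im]; positivity
  · rw [ray_re, ray_im]
    nlinarith [mul_pos hT hs]

lemma continuousOn_exp_I_mul_ray_cpow (hc : 0 ≤ Real.cos θ) (hT : 0 < T) :
    ContinuousOn (fun u : ℝ =>
      Complex.exp (Complex.I * ((T : ℂ) + u * Complex.exp (θ * Complex.I)) ^ (α : ℂ))) (Ici 0) := by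
  refine Complex.continuous_exp.comp_continuousOn (continuousOn_const.mul ?_)
  refine ContinuousOn.cpow (by fun_prop) continuousOn_const fun u hu => Or.inl ?_
  rw [ray_re]
  have : (0:ℝ) ≤ u := hu
  positivity

lemma integrableOn_ray (hα : 1 < α) (hθ0 : 0 < θ) (hθ : θ < Real.pi / 2)
    (hαθ : α * θ ≤ Real.pi / 2) (hT : 0 < T) (A : ℝ) :
    IntegrableOn (fun u : ℝ =>
      ‖Complex.exp (Complex.I * ((T : ℂ) + u * Complex.exp (θ * Complex.I)) ^ (α : ℂ))‖ *
        Real.exp (A * ‖(T : ℂ) + u * Complex.exp (θ * Complex.I)‖)) (Ioi 0) := by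
  have hc : 0 < Real.cos θ := Real.cos_pos_of_mem_Ioo ⟨by linarith, hθ⟩
  have hs : 0 < Real.sin θ := Real.sin_pos_of_pos_of_lt_pi hθ0 (by linarith)
  obtain ⟨U, hU0, hU⟩ : ∃ U : ℝ, 0 ≤ U ∧ ∀ u, U ≤ u → (|A| + 1) / Real.sin θ ≤ u ^ (α - 1) := by
    have := (tendsto_rpow_atTop (show 0 < α - 1 by linarith)).eventually_ge_atTop
      ((|A| + 1) / Real.sin θ)
    obtain ⟨U, hU⟩ := eventually_atTop.1 this
    exact ⟨max U 0, le_max_right _ _, fun u hu => hU u ((le_max_left _ _).trans hu)⟩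
  refine Integrable.mono' (g := fun u => Real.exp (|A| * T + (|A| + 1) * U) * Real.exp (-u))
    ((integrableOn_exp_neg_Ioi 0).const_mul _) ?_ ?_
  · refine ContinuousOn.aestronglyMeasurable ?_ measurableSet_Ioi
    refine ((continuousOn_exp_I_mul_ray_cpow hc.le hT).mono Ioi_subset_Ici_self).norm.mul ?_
    fun_prop
  · refine (ae_restrict_iff' measurableSet_Ioi).2 (Eventually.of_forall fun u hu => ?_)
    have hu : 0 < u := hu
    rw [Real.norm_of_nonneg (by positivity), ← Real.exp_add]
    refine (mul_le_mul_of_nonneg_right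
      (norm_exp_I_mul_ray_cpow_le hα.le hθ0 hθ hαθ hT hu.le) (by positivity)).trans ?_
    rw [← Real.exp_add]
    refine Real.exp_le_exp.2 ?_
    have h1 : u ^ (α - 1) ≤ ‖(T : ℂ) + u * Complex.exp (θ * Complex.I)‖ ^ (α - 1) :=
      Real.rpow_le_rpow hu.le (le_norm_ray_right hT.le hu.le hc.le) (by linarith)
    have h2 : A * ‖(T : ℂ) + u * Complex.exp (θ * Complex.I)‖ ≤ |A| * (T + u) :=
      (mul_le_mul_of_nonneg_right (le_abs_self A) (norm_nonneg _)).trans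
        (mul_le_mul_of_nonneg_left (norm_ray_le hT.le hu.le) (abs_nonneg A))
    have h3 := mul_le_mul_of_nonneg_right h1 (by positivity : 0 ≤ u * Real.sin θ)
    have h4 : (|A| + 1) * (u - U) ≤ u ^ (α - 1) * (u * Real.sin θ) := by
      rcases le_total U u with h | h
      · have h5 := (div_le_iff₀ hs).1 (hU u h)
        nlinarith [mul_le_mul_of_nonneg_right h5 hu.le, mul_nonneg (abs_nonneg A) hU0]
      · have : 0 ≤ u ^ (α - 1) * (u * Real.sin θ) := by positivity
        nlinarith [abs_nonneg A]
    nlinarith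
end Ray

/-- Comparison of the integrals of a holomorphic function along a horizontal segment and a
segment of slope `θ`, with the same starting point and the same length. -/
lemma norm_integral_sub_integral_ray_le {θ T R B : ℝ} (hs : 0 ≤ Real.sin θ)
    (hc : 0 ≤ Real.cos θ) (hT : 0 < T) (hR : 0 ≤ R) {F : ℂ → ℂ}
    (hF : DifferentiableOn ℂ F {z | 0 < z.re})
    (hB : ∀ z : ℂ, T + R * Real.cos θ ≤ z.re → 0 ≤ z.im →
      z.im * Real.cos θ ≤ z.re * Real.sin θ → ‖F z‖ ≤ B) :
    ‖(∫ u in (0:ℝ)..R, F ((T : ℂ) + u)) - Complex.exp (θ * Complex.I) *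
      ∫ u in (0:ℝ)..R, F ((T : ℂ) + u * Complex.exp (θ * Complex.I))‖ ≤ B * (2 * R) := by
  set ρ : ℝ := (T + R) ^ 2 / T with hρ
  have hρT : ρ * T = (T + R) ^ 2 := div_mul_cancel₀ _ hT.ne'
  have hρ0 : 0 < ρ := by positivity
  have hmem : ∀ z : ℂ, z ∈ Metric.ball (ρ : ℂ) ρ ↔ ‖z‖ ^ 2 < 2 * ρ * z.re := by
    intro z
    rw [mem_ball_iff_norm, ← sq_lt_sq₀ (norm_nonneg _) hρ0.le, Complex.sq_norm, Complex.sq_norm,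
      Complex.normSq_apply, Complex.normSq_apply]
    simp only [Complex.sub_re, Complex.sub_im, Complex.ofReal_re, Complex.ofReal_im]
    constructor <;> intro h <;> nlinarith
  have hball : Metric.ball (ρ : ℂ) ρ ⊆ {z | 0 < z.re} := by
    intro z hz
    have h1 := (hmem z).1 hz
    have h2 : 0 < 2 * ρ * z.re := lt_of_le_of_lt (sq_nonneg _) h1
    exact (mul_pos_iff_of_pos_left (by positivity)).1 h2
  obtain ⟨G, hG⟩ := (hF.mono hball).isExactOn_ball
  have hray : ∀ φ : ℝ, 0 ≤ Real.cos φ → ∀ u ∈ Icc (0:ℝ) R,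
      (T : ℂ) + u * Complex.exp (φ * Complex.I) ∈ Metric.ball (ρ : ℂ) ρ := by
    intro φ hφ u hu
    rw [hmem, ray_re]
    have h1 := norm_ray_le (θ := φ) hT.le hu.1
    have h2 : ‖(T : ℂ) + u * Complex.exp (φ * Complex.I)‖ ^ 2 ≤ (T + R) ^ 2 :=
      pow_le_pow_left₀ (norm_nonneg _) (h1.trans (by linarith [hu.2])) 2
    have h3 : 0 ≤ u * Real.cos φ := mul_nonneg hu.1 hφ
    nlinarith [mul_nonneg hρ0.le h3, sq_pos_of_pos (show 0 < T + R by linarith)]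
  have hint : ∀ φ : ℝ, 0 ≤ Real.cos φ → Complex.exp (φ * Complex.I) *
      ∫ u in (0:ℝ)..R, F ((T : ℂ) + u * Complex.exp (φ * Complex.I)) =
        G ((T : ℂ) + R * Complex.exp (φ * Complex.I)) - G T := by
    intro φ hφ
    rw [← intervalIntegral.integral_const_mul]
    have hd : ∀ u ∈ uIcc (0:ℝ) R, HasDerivAt
        (fun u : ℝ => G ((T : ℂ) + u * Complex.exp (φ * Complex.I)))
        (Complex.exp (φ * Complex.I) * F ((T : ℂ) + u * Complex.exp (φ * Complex.I))) u := by
      intro u hu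
      rw [uIcc_of_le hR] at hu
      have h1 : HasDerivAt (fun u : ℝ => (T : ℂ) + u * Complex.exp (φ * Complex.I))
          (Complex.exp (φ * Complex.I)) u := by
        simpa using (Complex.ofRealCLM.hasDerivAt.mul_const
          (Complex.exp (φ * Complex.I))).const_add (T : ℂ)
      rw [mul_comm (Complex.exp _) (F _)]
      exact (hG _ (hray φ hφ u hu)).comp u h1
    rw [intervalIntegral.integral_eq_sub_of_hasDerivAt hd]
    · simp
    · refine ContinuousOn.intervalIntegrable ?_
      rw [uIcc_of_le hR]
      refine continuousOn_const.mul ((hF.mono hball).continuousOn.comp (by fun_prop) ?_)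
      exact fun u hu => hray φ hφ u hu
  have h0 := hint 0 (by simp)
  simp only [Complex.ofReal_zero, zero_mul, Complex.exp_zero, one_mul, mul_one] at h0
  rw [h0, hint θ hc, sub_sub_sub_cancel_right]
  have hray0 := hray 0 (by simp) R ⟨hR, le_rfl⟩
  simp only [Complex.ofReal_zero, zero_mul, Complex.exp_zero, mul_one] at hray0
  have hconv : Convex ℝ ({z : ℂ | T + R * Real.cos θ ≤ z.re ∧ 0 ≤ z.im ∧
      z.im * Real.cos θ ≤ z.re * Real.sin θ} ∩ Metric.ball (ρ : ℂ) ρ) := by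
    refine Convex.inter ?_ (convex_ball _ _)
    rintro x ⟨hx1, hx2, hx3⟩ y ⟨hy1, hy2, hy3⟩ a b ha hb hab
    have hb' : b = 1 - a := by linarith
    simp only [mem_ofPred_eq, Complex.add_re, Complex.add_im, Complex.real_smul,
      Complex.re_ofReal_mul, Complex.im_ofReal_mul]
    refine ⟨?_, by positivity, ?_⟩
    · have h1 := mul_le_mul_of_nonneg_left hx1 ha
      have h2 := mul_le_mul_of_nonneg_left hy1 hb
      have h3 : (a + b) * (T + R * Real.cos θ) = T + R * Real.cos θ := by rw [hab, one_mul]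
      linarith
    · have h1 := mul_le_mul_of_nonneg_left hx3 ha
      have h2 := mul_le_mul_of_nonneg_left hy3 hb
      linarith
  have hB0 : 0 ≤ B := (norm_nonneg _).trans (hB ((T + R * Real.cos θ : ℝ) : ℂ) (Complex.ofReal_re _).ge (by simp)
    (by rw [Complex.ofReal_re, Complex.ofReal_im, zero_mul]; positivity))
  refine (hconv.norm_image_sub_le_of_norm_hasDerivWithin_le
    (fun z hz => (hG z hz.2).hasDerivWithinAt) (fun z hz => hB z hz.1.1 hz.1.2.1 hz.1.2.2)
    ⟨⟨?_, ?_, ?_⟩, hray θ hc R ⟨hR, le_rfl⟩⟩ ⟨⟨?_, ?_, ?_⟩, hray0⟩).trans ?_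
  · rw [ray_re]
  · rw [ray_im]; positivity
  · rw [ray_re, ray_im]; nlinarith [mul_nonneg hT.le hs]
  · simp only [Complex.add_re, Complex.ofReal_re]
    nlinarith [Real.cos_le_one θ]
  · simp
  · simp only [Complex.add_re, Complex.ofReal_re, Complex.add_im, Complex.ofReal_im, add_zero,
      zero_mul]
    positivity
  · refine mul_le_mul_of_nonneg_left ?_ hB0
    rw [add_sub_add_left_eq_sub]
    refine (norm_sub_le _ _).trans (le_of_eq ?_)
    rw [norm_mul, Complex.norm_exp_ofReal_mul_I, Complex.norm_real, Real.norm_of_nonneg hR]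
    ring

lemma integrableOn_laplace {α : ℝ} (hα : 0 ≤ α) {s : ℂ} (hs : 0 < s.re) :
    IntegrableOn (fun t : ℝ =>
      Complex.exp (Complex.I * (↑(t ^ α) : ℂ)) * Complex.exp (-(s * t))) (Ioi 0) := by
  refine Integrable.mono' (integrableOn_exp_mul_Ioi (neg_neg_iff_pos.2 hs) 0) ?_
    (Eventually.of_forall fun t => le_of_eq ?_)
  · have : Continuous fun t : ℝ => t ^ α := Real.continuous_rpow_const hα
    refine Continuous.aestronglyMeasurable ?_
    fun_prop
  · rw [norm_mul, mul_comm Complex.I, Complex.norm_exp_ofReal_mul_I, one_mul, norm_exp_neg_mul]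
    simp

/-- The Laplace transform of `exp (i t ^ α)` taken along the contour that follows the real axis up
to `T` and then the ray of direction `exp (iθ)`. -/
noncomputable def bentLaplace (α θ T : ℝ) (s : ℂ) : ℂ :=
  (∫ t in Ioc (0:ℝ) T, Complex.exp (Complex.I * (↑(t ^ α) : ℂ)) * Complex.exp (-(s * t))) +
    Complex.exp (θ * Complex.I) * ∫ u in Ioi (0:ℝ),
      Complex.exp (Complex.I * ((T : ℂ) + u * Complex.exp (θ * Complex.I)) ^ (α : ℂ)) *
        Complex.exp (-(s * ((T : ℂ) + u * Complex.exp (θ * Complex.I))))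

section BentLaplace

variable {α θ T : ℝ}

lemma differentiable_bentLaplace (hα : 1 < α) (hθ0 : 0 < θ) (hθ : θ < Real.pi / 2)
    (hαθ : α * θ ≤ Real.pi / 2) (hT : 0 < T) : Differentiable ℂ (bentLaplace α θ T) := by
  have hc : 0 < Real.cos θ := Real.cos_pos_of_mem_Ioo ⟨by linarith, hθ⟩
  have hpow : Continuous fun t : ℝ => t ^ α := Real.continuous_rpow_const (by linarith)
  refine Differentiable.add ?_ (Differentiable.const_mul ?_ _)
  · refine differentiable_integral_mul_exp (p := fun t : ℝ => (t : ℂ)) ?_ ?_ fun A => ?_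
    · exact Continuous.aestronglyMeasurable (by fun_prop)
    · exact Continuous.aestronglyMeasurable (by fun_prop)
    · refine IntegrableOn.mono_set (Continuous.integrableOn_Icc ?_) Ioc_subset_Icc_self
      fun_prop
  · refine differentiable_integral_mul_exp
      (p := fun u : ℝ => (T : ℂ) + u * Complex.exp (θ * Complex.I)) ?_ ?_
      (integrableOn_ray hα hθ0 hθ hαθ hT)
    · exact ((continuousOn_exp_I_mul_ray_cpow hc.le hT).mono
        Ioi_subset_Ici_self).aestronglyMeasurable measurableSet_Ioi
    · exact Continuous.aestronglyMeasurable (by fun_prop)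

lemma integrableOn_ray_mul_exp (hα : 1 < α) (hθ0 : 0 < θ) (hθ : θ < Real.pi / 2)
    (hαθ : α * θ ≤ Real.pi / 2) (hT : 0 < T) (s : ℂ) :
    IntegrableOn (fun u : ℝ =>
      Complex.exp (Complex.I * ((T : ℂ) + u * Complex.exp (θ * Complex.I)) ^ (α : ℂ)) *
        Complex.exp (-(s * ((T : ℂ) + u * Complex.exp (θ * Complex.I))))) (Ioi 0) := by
  have hc : 0 < Real.cos θ := Real.cos_pos_of_mem_Ioo ⟨by linarith, hθ⟩
  refine (integrableOn_ray hα hθ0 hθ hαθ hT ‖s‖).mono' ?_ (Eventually.of_forall fun u => ?_)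
  · refine ContinuousOn.aestronglyMeasurable (((continuousOn_exp_I_mul_ray_cpow hc.le hT).mono
        Ioi_subset_Ici_self).mul ?_) measurableSet_Ioi
    fun_prop
  · rw [norm_mul]
    refine mul_le_mul_of_nonneg_left ((Complex.norm_exp_le_exp_norm _).trans (le_of_eq ?_))
      (norm_nonneg _)
    rw [norm_neg, norm_mul]

lemma bentLaplace_eq (hα : 1 < α) (hθ0 : 0 < θ) (hθ : θ < Real.pi / 2)
    (hαθ : α * θ ≤ Real.pi / 2) (hT : 0 < T) {s : ℂ} (hs : 0 < s.re) :
    bentLaplace α θ T s = ∫ t in Ioi (0:ℝ),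
      Complex.exp (Complex.I * (↑(t ^ α) : ℂ)) * Complex.exp (-(s * t)) := by
  have hc : 0 < Real.cos θ := Real.cos_pos_of_mem_Ioo ⟨by linarith, hθ⟩
  have hsin : 0 < Real.sin θ := Real.sin_pos_of_pos_of_lt_pi hθ0 (by linarith)
  have hint := integrableOn_laplace (by linarith : 0 ≤ α) hs
  rw [← Ioc_union_Ioi_eq_Ioi hT.le, setIntegral_union (Ioc_disjoint_Ioi le_rfl) measurableSet_Ioi
    (hint.mono_set Ioc_subset_Ioi_self) (hint.mono_set (Ioi_subset_Ioi hT.le)), bentLaplace]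
  congr 1
  set F : ℂ → ℂ := fun z => Complex.exp (Complex.I * z ^ (α : ℂ)) * Complex.exp (-(s * z)) with hF
  have hFd : DifferentiableOn ℂ F {z | 0 < z.re} := by
    intro z hz
    refine DifferentiableAt.differentiableWithinAt ?_
    have : DifferentiableAt ℂ (fun z : ℂ => z ^ (α : ℂ)) z :=
      differentiableAt_id.cpow_const (Or.inl hz)
    fun_prop
  have hlim_real : Tendsto (fun R : ℝ => ∫ u in (0:ℝ)..R, F ((T : ℂ) + u)) atTop
      (𝓝 (∫ t in Ioi T, Complex.exp (Complex.I * (↑(t ^ α) : ℂ)) * Complex.exp (-(s * t)))) := by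
    refine (intervalIntegral_tendsto_integral_Ioi T (hint.mono_set (Ioi_subset_Ioi hT.le))
      (tendsto_atTop_add_const_left atTop T tendsto_id)).congr' ?_
    filter_upwards [eventually_ge_atTop 0] with R hR
    have h1 := intervalIntegral.integral_comp_add_left (a := 0) (b := R) (fun t : ℝ =>
      Complex.exp (Complex.I * (↑(t ^ α) : ℂ)) * Complex.exp (-(s * t))) T
    rw [add_zero] at h1
    rw [id, ← h1]
    refine intervalIntegral.integral_congr fun u hu => ?_
    rw [uIcc_of_le hR] at hu
    simp only [hF, Complex.ofReal_cpow (by linarith [hu.1] : 0 ≤ T + u), Complex.ofReal_add]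
  have hlim_ray := (intervalIntegral_tendsto_integral_Ioi 0
    (integrableOn_ray_mul_exp hα hθ0 hθ hαθ hT s) tendsto_id).const_mul
      (Complex.exp (θ * Complex.I))
  have hdiff := hlim_real.sub hlim_ray
  have hzero : Tendsto (fun R : ℝ => Real.exp (-(s.re * (T + R * Real.cos θ))) * (2 * R)) atTop
      (𝓝 0) := by
    have h1 := (tendsto_rpow_mul_exp_neg_mul_atTop_nhds_zero 1 (s.re * Real.cos θ)
      (by positivity)).const_mul (2 * Real.exp (-(s.re * T)))
    rw [mul_zero] at h1
    refine h1.congr fun R => ?_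
    rw [Real.rpow_one, show -(s.re * (T + R * Real.cos θ)) =
      -(s.re * T) + -(s.re * Real.cos θ) * R by ring, Real.exp_add]
    ring
  have hle : ∀ᶠ R : ℝ in atTop, |s.im| ≤ (R * Real.cos θ) ^ (α - 1) :=
    ((tendsto_rpow_atTop (show 0 < α - 1 by linarith)).comp
      (tendsto_id.atTop_mul_const hc)).eventually_ge_atTop _
  refine (sub_eq_zero.1 (tendsto_nhds_unique hdiff (squeeze_zero_norm' ?_ hzero))).symm
  filter_upwards [hle, eventually_ge_atTop 0] with R hR hR0
  refine norm_integral_sub_integral_ray_le hsin.le hc.le hT hR0 hFd fun z hz1 hz2 hz3 => ?_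
  have hRc : 0 ≤ R * Real.cos θ := by positivity
  rw [hF, norm_mul, norm_exp_neg_mul]
  refine (mul_le_mul_of_nonneg_right (norm_exp_I_mul_cpow_le hα.le hθ0 hθ hαθ (by linarith)
    hz2 hz3) (Real.exp_pos _).le).trans ?_
  rw [← Real.exp_add]
  refine Real.exp_le_exp.2 ?_
  have h1 : (R * Real.cos θ) ^ (α - 1) ≤ ‖z‖ ^ (α - 1) :=
    Real.rpow_le_rpow hRc (by linarith [Complex.re_le_norm z]) (by linarith)
  have h2 : s.im * z.im ≤ ‖z‖ ^ (α - 1) * z.im :=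
    mul_le_mul_of_nonneg_right ((le_abs_self _).trans (hR.trans h1)) hz2
  have h3 := mul_le_mul_of_nonneg_left hz1 hs.le
  linarith

lemma bentLaplace_eq_bentLaplace (hα : 1 < α) (hθ0 : 0 < θ) (hθ : θ < Real.pi / 2)
    (hαθ : α * θ ≤ Real.pi / 2) {T' : ℝ} (hT : 0 < T) (hT' : 0 < T') :
    bentLaplace α θ T = bentLaplace α θ T' := by
  refine AnalyticOnNhd.eq_of_eventuallyEq (𝕜 := ℂ) (z₀ := 1)
    (fun z _ => (differentiable_bentLaplace hα hθ0 hθ hαθ hT).analyticAt z)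
    (fun z _ => (differentiable_bentLaplace hα hθ0 hθ hαθ hT').analyticAt z) ?_
  have h1 : {s : ℂ | 0 < s.re} ∈ 𝓝 (1 : ℂ) :=
    (isOpen_lt continuous_const Complex.continuous_re).mem_nhds (by simp)
  filter_upwards [h1] with s hs
  rw [bentLaplace_eq hα hθ0 hθ hαθ hT hs, bentLaplace_eq hα hθ0 hθ hαθ hT' hs]

/-- If the bend is placed beyond the stationary point of the phase, the ray contributes at most
the size of the integrand at the bend. -/
lemma norm_bentLaplace_le (hα : 1 < α) (hθ0 : 0 < θ) (hθ : θ < Real.pi / 2)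
    (hαθ : α * θ ≤ Real.pi / 2) (hT : 0 < T) {s : ℂ} {b : ℝ} (hb : 0 ≤ b) (hs : -b ≤ s.re)
    (hTs : |s.im| + (b + 1) / Real.sin θ ≤ T ^ (α - 1)) :
    ‖bentLaplace α θ T s‖ ≤ (T + 1) * Real.exp (b * T) := by
  have hc : 0 < Real.cos θ := Real.cos_pos_of_mem_Ioo ⟨by linarith, hθ⟩
  have hsin : 0 < Real.sin θ := Real.sin_pos_of_pos_of_lt_pi hθ0 (by linarith)
  have hreal : ‖∫ t in Ioc (0:ℝ) T,
      Complex.exp (Complex.I * (↑(t ^ α) : ℂ)) * Complex.exp (-(s * t))‖ ≤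
        Real.exp (b * T) * T := by
    refine (norm_setIntegral_le_of_norm_le_const (C := Real.exp (b * T)) (by simp)
      fun t ht => ?_).trans (le_of_eq ?_)
    · rw [norm_mul, mul_comm Complex.I, Complex.norm_exp_ofReal_mul_I, one_mul, norm_exp_neg_mul]
      refine Real.exp_le_exp.2 ?_
      simp only [Complex.ofReal_re, Complex.ofReal_im, mul_zero, add_zero]
      nlinarith [ht.1, ht.2, mul_le_mul_of_nonneg_left ht.2 hb]
    · simp [hT.le]
  have hray : ‖∫ u in Ioi (0:ℝ),
      Complex.exp (Complex.I * ((T : ℂ) + u * Complex.exp (θ * Complex.I)) ^ (α : ℂ)) *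
        Complex.exp (-(s * ((T : ℂ) + u * Complex.exp (θ * Complex.I))))‖ ≤ Real.exp (b * T) := by
    refine (norm_integral_le_of_norm_le (g := fun u => Real.exp (b * T) * Real.exp (-u))
      ((integrableOn_exp_neg_Ioi 0).const_mul _) ?_).trans (le_of_eq ?_)
    · refine (ae_restrict_iff' measurableSet_Ioi).2 (Eventually.of_forall fun u hu => ?_)
      have hu : 0 < u := hu
      rw [norm_mul, norm_exp_neg_mul, ray_re, ray_im]
      refine (mul_le_mul_of_nonneg_right
        (norm_exp_I_mul_ray_cpow_le hα.le hθ0 hθ hαθ hT hu.le) (Real.exp_pos _).le).trans ?_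
      rw [← Real.exp_add, ← Real.exp_add]
      refine Real.exp_le_exp.2 ?_
      have h1 : T ^ (α - 1) ≤ ‖(T : ℂ) + u * Complex.exp (θ * Complex.I)‖ ^ (α - 1) :=
        Real.rpow_le_rpow hT.le (le_norm_ray_left hu.le hc.le) (by linarith)
      have h2 := mul_le_mul_of_nonneg_right (hTs.trans h1)
        (by positivity : 0 ≤ u * Real.sin θ)
      have h3 : (|s.im| + (b + 1) / Real.sin θ) * (u * Real.sin θ) =
          |s.im| * (u * Real.sin θ) + (b + 1) * u := by
        field_simp
      have h4 : s.im * (u * Real.sin θ) ≤ |s.im| * (u * Real.sin θ) :=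
        mul_le_mul_of_nonneg_right (le_abs_self _) (by positivity)
      have h5 : -b * (T + u * Real.cos θ) ≤ s.re * (T + u * Real.cos θ) :=
        mul_le_mul_of_nonneg_right hs (by positivity)
      have h6 : b * (u * Real.cos θ) ≤ b * u :=
        mul_le_mul_of_nonneg_left (mul_le_of_le_one_right hu.le (Real.cos_le_one θ)) hb
      linarith
    · rw [integral_const_mul, integral_exp_neg_Ioi_zero, mul_one]
  rw [bentLaplace]
  refine (norm_add_le _ _).trans ?_
  rw [norm_mul, Complex.norm_exp_ofReal_mul_I]
  linarith

end BentLaplace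

/-- The Laplace transform of `τ(t) = exp(i t^{1+1/κ})` converges absolutely
for `Re s > 0`, extends to an entire function, and satisfies polynomial
bounds on the region `Re s ≥ −C log(2+|Im s|)/(1+|Im s|)^κ` for every
`C > 0`. -/
theorem stmt_19 (κ : ℝ) (hκ : 0 < κ) :
    (∀ s : ℂ, 0 < s.re → IntegrableOn (fun t : ℝ =>
      Complex.exp (Complex.I * (↑(t ^ (1 + 1/κ)) : ℂ)) * Complex.exp (-(s * t)))
      (Ioi 0)) ∧
    ∃ L : ℂ → ℂ, Differentiable ℂ L ∧
      (∀ s : ℂ, 0 < s.re → L s = ∫ t in Ioi (0:ℝ),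
        Complex.exp (Complex.I * (↑(t ^ (1 + 1/κ)) : ℂ)) * Complex.exp (-(s * t))) ∧
      ∀ C : ℝ, 0 < C → ∃ M N : ℝ, 0 < M ∧ 0 ≤ N ∧
        ∀ s : ℂ, -C * Real.log (2 + |s.im|) / (1 + |s.im|) ^ κ ≤ s.re →
          ‖L s‖ ≤ M * (1 + ‖s‖) ^ N := by
  have hκ' : 0 < 1 / κ := by positivity
  set α : ℝ := 1 + 1 / κ with hαdef
  have hα : 1 < α := by linarith
  set θ : ℝ := Real.pi / 2 / α with hθdef
  have hθ0 : 0 < θ := by positivity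
  have hθ : θ < Real.pi / 2 := div_lt_self (by positivity) hα
  have hαθ : α * θ ≤ Real.pi / 2 := (mul_div_cancel₀ _ (by positivity)).le
  have hsin : 0 < Real.sin θ := Real.sin_pos_of_pos_of_lt_pi hθ0 (by linarith [Real.pi_pos])
  refine ⟨fun s hs => integrableOn_laplace (by linarith) hs, bentLaplace α θ 1,
    differentiable_bentLaplace hα hθ0 hθ hαθ one_pos,
    fun s hs => bentLaplace_eq hα hθ0 hθ hαθ one_pos hs, fun C hC => ?_⟩
  set b₀ : ℝ := C * (2 ^ κ / κ) with hb₀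
  set D : ℝ := 1 + (b₀ + 1) / Real.sin θ with hD
  have hD0 : 0 < D := by positivity
  set K : ℝ := D ^ κ with hK
  have hK0 : 0 < K := by positivity
  refine ⟨(K + 1) * 2 ^ (C * K), κ + C * K, by positivity, by positivity, fun s hs => ?_⟩
  set y : ℝ := |s.im| with hy
  have hy0 : 0 ≤ y := abs_nonneg _
  have hyk : 0 < (1 + y) ^ κ := by positivity
  set b : ℝ := C * Real.log (2 + y) / (1 + y) ^ κ with hb
  have hlog : 0 ≤ Real.log (2 + y) := Real.log_nonneg (by linarith)
  have hb0 : 0 ≤ b := by positivity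
  have hbs : -b ≤ s.re := by
    rw [hb]
    convert hs using 1
    ring
  have hbb₀ : b ≤ b₀ := by
    rw [hb, hb₀, div_le_iff₀ hyk, mul_assoc]
    refine mul_le_mul_of_nonneg_left ?_ hC.le
    calc Real.log (2 + y) ≤ (2 + y) ^ κ / κ := Real.log_le_rpow_div (by linarith) hκ
      _ ≤ (2 * (1 + y)) ^ κ / κ := by gcongr; linarith
      _ = 2 ^ κ / κ * (1 + y) ^ κ := by
          rw [Real.mul_rpow (by norm_num) (by linarith)]; ring
  set T : ℝ := K * (1 + y) ^ κ with hTdef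
  have hT : 0 < T := by positivity
  have hTpow : T ^ (α - 1) = D * (1 + y) := by
    rw [hTdef, hK, ← Real.mul_rpow hD0.le (by linarith), ← Real.rpow_mul (by positivity),
      hαdef, add_sub_cancel_left, mul_one_div_cancel hκ.ne', Real.rpow_one]
  have hTs : |s.im| + (b + 1) / Real.sin θ ≤ T ^ (α - 1) := by
    rw [hTpow, hD]
    have h1 : (b + 1) / Real.sin θ ≤ (b₀ + 1) / Real.sin θ := by gcongr
    have h2 : 0 ≤ (b₀ + 1) / Real.sin θ * y := by positivity
    linarith
  have hexp : Real.exp (b * T) = (2 + y) ^ (C * K) := by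
    rw [Real.rpow_def_of_pos (by linarith), hb, hTdef]
    congr 1
    field_simp
  rw [bentLaplace_eq_bentLaplace hα hθ0 hθ hαθ one_pos hT]
  refine (norm_bentLaplace_le hα hθ0 hθ hαθ hT hb0 hbs hTs).trans ?_
  rw [hexp]
  have hCK : 0 ≤ C * K := by positivity
  have h1 : T + 1 ≤ (K + 1) * (1 + y) ^ κ := by
    have := Real.one_le_rpow (show 1 ≤ 1 + y by linarith) hκ.le
    rw [hTdef]
    linarith
  have h2 : (2 + y) ^ (C * K) ≤ 2 ^ (C * K) * (1 + y) ^ (C * K) := by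
    rw [← Real.mul_rpow (by norm_num) (by linarith)]
    exact Real.rpow_le_rpow (by linarith) (by linarith) hCK
  calc (T + 1) * (2 + y) ^ (C * K)
      ≤ ((K + 1) * (1 + y) ^ κ) * (2 ^ (C * K) * (1 + y) ^ (C * K)) := by gcongr
    _ = (K + 1) * 2 ^ (C * K) * (1 + y) ^ (κ + C * K) := by
        rw [Real.rpow_add (by linarith)]; ring
    _ ≤ (K + 1) * 2 ^ (C * K) * (1 + ‖s‖) ^ (κ + C * K) := by
        gcongr
        exact Complex.abs_im_le_norm s
end
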